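/- arXiv:2404.17993 — 2 statements merged into one kernel-verified Lean document; each statement's English description precedes it below -/
import Mathlib

section
/- Let h_1, ..., h_K be real multivariate polynomials in N unknowns x and M unknowns a with K ≥ N, defining the map h : ℝ^N × ℝ^M → ℝ^K. Let b ∈ ℝ^M and let g : ℝ^M → ℝ^N be differentiable at b with h(g(a), a) = 0 for all a in some neighborhood of b. If the K×N Jacobian matrix J_x = [∂h_k/∂x_n](g(b), b) has rank N (full column rank), then the Jacobian of g at b is uniquely determined and equals Dg(b) = −(J_xᵀ J_x)⁻¹ J_xᵀ J_a, where J_a = [∂h_k/∂a_m](g(b), b); in particular (J_xᵀ J_x)⁻¹ J_xᵀ is the Moore–Penrose pseudoinverse of J_x. -/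
open scoped Matrix

/-- Chain rule for the evaluation of a multivariate polynomial along a differentiable map. -/
theorem MvPolynomial.hasFDerivAt_eval_comp {𝕜 E σ : Type*} [NontriviallyNormedField 𝕜]
    [NormedAddCommGroup E] [NormedSpace 𝕜 E] [Fintype σ] {c : E → σ → 𝕜} {c' : σ → E →L[𝕜] 𝕜}
    {b : E} (hc : ∀ i, HasFDerivAt (fun a => c a i) (c' i) b) (p : MvPolynomial σ 𝕜) :
    HasFDerivAt (fun a => eval (c a) p) (∑ i, eval (c b) (pderiv i p) • c' i) b := by
  classical
  induction p using MvPolynomial.induction_on with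
  | C r =>
    simp only [eval_C]
    refine (hasFDerivAt_const r b).congr_fderiv ?_
    ext v
    simp
  | add p q hp hq =>
    simp only [map_add]
    refine (hp.add hq).congr_fderiv ?_
    ext v
    simp [add_mul, Finset.sum_add_distrib]
  | mul_X p j hp =>
    simp only [map_mul, eval_X]
    refine (hp.mul (hc j)).congr_fderiv ?_
    have hX : ∀ i, eval (c b) (pderiv i (X j : MvPolynomial σ 𝕜)) = if i = j then 1 else 0 := by
      intro i
      rw [pderiv_X, Pi.single_apply]
      split_ifs <;> simp_all
    ext v
    simp [-pderiv_X, Derivation.leibniz, hX, add_mul, Finset.sum_add_distrib, Finset.mul_sum,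
      mul_assoc]

/-- Two derivatives represented by matrices agree. -/
theorem HasFDerivAt.matrix_unique {m n : Type*} [Fintype m] [Fintype n]
    {g : (m → ℝ) → n → ℝ} {b : m → ℝ} {A B : Matrix n m ℝ}
    (hA : HasFDerivAt g (LinearMap.toContinuousLinearMap A.mulVecLin) b)
    (hB : HasFDerivAt g (LinearMap.toContinuousLinearMap B.mulVecLin) b) : A = B := by
  classical
  exact Matrix.toLin'.injective (LinearMap.toContinuousLinearMap.injective (hA.unique hB))

/-- The Gram matrix of a real matrix with full column rank is invertible. -/
theorem Matrix.isUnit_det_transpose_mul_self {m n : Type*} [Fintype m] [Fintype n]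
    [DecidableEq n] {A : Matrix m n ℝ} (hA : A.rank = Fintype.card n) : IsUnit (Aᵀ * A).det := by
  rw [← Matrix.isUnit_iff_isUnit_det, ← Matrix.linearIndependent_cols_iff_isUnit,
    linearIndependent_iff_card_eq_finrank_span, Set.finrank, ← Matrix.rank_eq_finrank_span_cols,
    Matrix.rank_transpose_mul_self, hA]



/-- Differentiating an implicitly defined solution of an overdetermined real polynomial
system with full column rank Jacobian: the Jacobian of `g` at `b` is uniquely determined
and equals `-(J_xᵀ J_x)⁻¹ J_xᵀ J_a`; moreover `(J_xᵀ J_x)⁻¹ J_xᵀ` is the Moore–Penrose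
pseudoinverse of `J_x` (it satisfies the four Penrose conditions). -/
theorem stmt_3 (N M K : ℕ) (hKN : K ≥ N)
    (h : Fin K → MvPolynomial (Fin N ⊕ Fin M) ℝ)
    (b : Fin M → ℝ) (g : (Fin M → ℝ) → (Fin N → ℝ))
    (Dg : Matrix (Fin N) (Fin M) ℝ)
    (hg : HasFDerivAt g (LinearMap.toContinuousLinearMap (Matrix.mulVecLin Dg)) b)
    (hsol : ∀ᶠ a in nhds b, ∀ k, MvPolynomial.eval (Sum.elim (g a) a) (h k) = 0)
    (Jx : Matrix (Fin K) (Fin N) ℝ)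
    (hJx : ∀ k n, Jx k n =
      MvPolynomial.eval (Sum.elim (g b) b) (MvPolynomial.pderiv (Sum.inl n) (h k)))
    (hrank : Jx.rank = N)
    (Ja : Matrix (Fin K) (Fin M) ℝ)
    (hJa : ∀ k m, Ja k m =
      MvPolynomial.eval (Sum.elim (g b) b) (MvPolynomial.pderiv (Sum.inr m) (h k))) :
    Dg = -((Jxᵀ * Jx)⁻¹ * Jxᵀ * Ja) ∧
    (∀ Dg' : Matrix (Fin N) (Fin M) ℝ,
      HasFDerivAt g (LinearMap.toContinuousLinearMap (Matrix.mulVecLin Dg')) b →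
      Dg' = Dg) ∧
    Jx * ((Jxᵀ * Jx)⁻¹ * Jxᵀ) * Jx = Jx ∧
    ((Jxᵀ * Jx)⁻¹ * Jxᵀ) * Jx * ((Jxᵀ * Jx)⁻¹ * Jxᵀ) = (Jxᵀ * Jx)⁻¹ * Jxᵀ ∧
    (Jx * ((Jxᵀ * Jx)⁻¹ * Jxᵀ))ᵀ = Jx * ((Jxᵀ * Jx)⁻¹ * Jxᵀ) ∧
    (((Jxᵀ * Jx)⁻¹ * Jxᵀ) * Jx)ᵀ = ((Jxᵀ * Jx)⁻¹ * Jxᵀ) * Jx := by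
  have hU := Matrix.isUnit_det_transpose_mul_self (hrank.trans (Fintype.card_fin N).symm)
  have hinv : ((Jxᵀ * Jx)⁻¹ * Jxᵀ) * Jx = 1 := by
    rw [Matrix.mul_assoc, Matrix.nonsing_inv_mul _ hU]
  have hlin : Jx * Dg + Ja = 0 := by
    ext k m
    have hgi := hasFDerivAt_pi'.1 hg
    have hc : ∀ i : Fin N ⊕ Fin M, HasFDerivAt (fun a => Sum.elim (g a) a i)
        (Sum.elim (fun n => (ContinuousLinearMap.proj n).comp
          (LinearMap.toContinuousLinearMap (Matrix.mulVecLin Dg)))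
          (fun m => ContinuousLinearMap.proj m) i) b := by
      rintro (n | m)
      · exact hgi n
      · exact hasFDerivAt_apply m b
    have hzero : HasFDerivAt (fun a => MvPolynomial.eval (Sum.elim (g a) a) (h k))
        (0 : (Fin M → ℝ) →L[ℝ] ℝ) b :=
      (hasFDerivAt_const (0 : ℝ) b).congr_of_eventuallyEq (hsol.mono fun a ha => ha k)
    have key := DFunLike.congr_fun
      ((MvPolynomial.hasFDerivAt_eval_comp hc (h k)).unique hzero) (Pi.single m 1)
    simpa [Fintype.sum_sum_type, ← hJx, ← hJa, Matrix.mul_apply, Pi.single_apply] using key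
  refine ⟨?_, fun _ hD => hD.matrix_unique hg, ?_, ?_, ?_, ?_⟩
  · rw [eq_neg_of_add_eq_zero_right hlin, Matrix.mul_neg, neg_neg, ← Matrix.mul_assoc, hinv,
      Matrix.one_mul]
  · rw [Matrix.mul_assoc, hinv, Matrix.mul_one]
  · rw [hinv, Matrix.one_mul]
  · simp [Matrix.transpose_mul, Matrix.transpose_nonsing_inv, Matrix.mul_assoc]
  · rw [hinv, Matrix.transpose_one]
end

section
/- Let t ∈ ℝ³, let R be a 3×3 real matrix with RᵀR = I and det R = 1, and let [t]_× denote the 3×3 skew-symmetric matrix with ([t]_×)v = t × v for all v ∈ ℝ³. Then the essential matrix E = [t]_× R satisfies the trace constraint 2 E Eᵀ E = tr(E Eᵀ) E. -/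
open scoped Matrix

/-- A matrix acting as the cross product with `t` is the skew-symmetric matrix `[t]ₓ`. -/
theorem eq_of_mulVec_eq_crossProduct {A : Type*} [CommRing A] {t : Fin 3 → A}
    {T : Matrix (Fin 3) (Fin 3) A} (hT : ∀ v : Fin 3 → A, T.mulVec v = crossProduct t v) :
    T = !![0, -t 2, t 1; t 2, 0, -t 0; -t 1, t 0, 0] := by
  refine Matrix.mulVec_injective (funext fun v => ?_)
  rw [hT v, cross_apply]
  ext i
  fin_cases i <;> simp [Matrix.mulVec, dotProduct, Fin.sum_univ_three] <;> ring

/-- The skew-symmetric matrix `[t]ₓ` satisfies the trace constraint. -/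
theorem two_smul_mul_transpose_mul_crossMatrix {A : Type*} [CommRing A] (a b c : A) :
    let T : Matrix (Fin 3) (Fin 3) A := !![0, -c, b; c, 0, -a; -b, a, 0]
    (2 : A) • (T * Tᵀ * T) = Matrix.trace (T * Tᵀ) • T := by
  intro T
  ext i j
  fin_cases i <;> fin_cases j <;>
    simp only [Matrix.smul_apply, Matrix.mul_apply, Matrix.trace, Matrix.diag_apply,
      Matrix.transpose_apply, Fin.sum_univ_three] <;>
    simp [T] <;> ring

/-- An essential matrix `E = [t]ₓ R`, with `R` a rotation matrix and `[t]ₓ` the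
cross-product (skew-symmetric) matrix of `t`, satisfies the trace constraint
`2 E Eᵀ E = tr(E Eᵀ) E`. -/
theorem stmt_10 (t : Fin 3 → ℝ) (R : Matrix (Fin 3) (Fin 3) ℝ)
    (hR : Rᵀ * R = 1) (hdet : R.det = 1)
    (Tx : Matrix (Fin 3) (Fin 3) ℝ)
    (hTx : ∀ v : Fin 3 → ℝ, Tx.mulVec v = crossProduct t v)
    (E : Matrix (Fin 3) (Fin 3) ℝ) (hE : E = Tx * R) :
    (2 : ℝ) • (E * Eᵀ * E) = Matrix.trace (E * Eᵀ) • E := by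
  have hEE : E * Eᵀ = Tx * Txᵀ := by
    rw [hE, Matrix.transpose_mul, Matrix.mul_assoc, ← Matrix.mul_assoc R,
      mul_eq_one_comm.mp hR, Matrix.one_mul]
  have hT : (2 : ℝ) • (Tx * Txᵀ * Tx) = Matrix.trace (Tx * Txᵀ) • Tx := by
    rw [eq_of_mulVec_eq_crossProduct hTx]
    exact two_smul_mul_transpose_mul_crossMatrix (t 0) (t 1) (t 2)
  rw [hEE, hE, ← Matrix.mul_assoc, ← Matrix.smul_mul, hT, Matrix.smul_mul]
end
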